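/- arXiv:1810.03960 — 2 statements merged into one kernel-verified Lean document; each statement's English description precedes it below -/
import Mathlib

section
/- If G is a primitive permutation group of degree n containing a cycle of prime length l with l ≤ n − 3, then G contains the alternating group A_n. -/
/-- A permutation group action is primitive if it is transitive and every block
is trivial (a subsingleton or the whole set). -/
def IsPrimitiveAction (G X : Type*) [Group G] [MulAction G X] : Prop :=
  MulAction.IsPretransitive G X ∧
    ∀ B : Set X, MulAction.IsBlock G B → B.Subsingleton ∨ B = Set.univ

open Equiv MulAction in
/-- Elements of order `p` in a group whose order divides `p!` generate conjugate subgroups. -/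
theorem sylow_conj_aux {K : Type*} [Group K] [Finite K] {p : ℕ} (hp : p.Prime)
    (hK : Nat.card K ∣ p.factorial) (s s' : K) (hs : orderOf s = p) (hs' : orderOf s' = p) :
    ∃ k : K, k * s' * k⁻¹ ∈ Subgroup.zpowers s := by
  have : Fact p.Prime := ⟨hp⟩
  have hdvd : p ∣ Nat.card K := hs ▸ orderOf_dvd_natCard s
  have hsq : ¬ p ^ 2 ∣ Nat.card K := by
    intro h
    have h2 := h.trans hK
    obtain ⟨q, rfl⟩ : ∃ q, p = q + 1 := ⟨p - 1, by have := hp.pos; omega⟩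
    rw [Nat.factorial_succ, pow_two] at h2
    have h3 := Nat.dvd_of_mul_dvd_mul_left hp.pos h2
    have := (Nat.Prime.dvd_factorial hp).1 h3
    omega
  have hfac : (Nat.card K).factorization p = 1 := by
    have hne : Nat.card K ≠ 0 := Nat.card_pos.ne'
    have h1 := (hp.dvd_iff_one_le_factorization hne).1 hdvd
    have h2 : ¬ 2 ≤ (Nat.card K).factorization p := fun h =>
      hsq ((hp.pow_dvd_iff_le_factorization hne).2 h)
    omega
  let P : Sylow p K := Sylow.ofCard (Subgroup.zpowers s) (by
    rw [hfac, Nat.card_zpowers, hs, pow_one])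
  let P' : Sylow p K := Sylow.ofCard (Subgroup.zpowers s') (by
    rw [hfac, Nat.card_zpowers, hs', pow_one])
  obtain ⟨k, hk⟩ := exists_smul_eq K P' P
  refine ⟨k, ?_⟩
  have h1 : s' ∈ P' := Subgroup.mem_zpowers s'
  have h2 : k * s' * k⁻¹ ∈ k • P' := by
    have := Subgroup.smul_mem_pointwise_smul s' (MulAut.conj k) (P' : Subgroup K) h1
    simpa using! this
  rw [hk] at h2
  exact h2

open Equiv in
/-- Conjugacy of `p`-cycles with the same support inside a permutation group. -/
theorem perm_conj_aux {Ω : Type*} [Fintype Ω] [DecidableEq Ω] (G : Subgroup (Perm Ω))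
    (σ σ' : Perm Ω) (hσ : σ ∈ G) (hσ' : σ' ∈ G) (hp : (σ.support.card).Prime)
    (ho : orderOf σ = σ.support.card) (ho' : orderOf σ' = σ.support.card)
    (hsupp : σ'.support = σ.support) :
    ∃ k ∈ G, (∀ x ∉ σ.support, k x = x) ∧ k * σ' * k⁻¹ ∈ Subgroup.zpowers σ := by
  let f : Perm {x // x ∈ σ.support} →* Perm Ω := Perm.ofSubtype
  have hf : Function.Injective f := Perm.ofSubtype_injective
  let K := G.comap f
  have lift : ∀ τ ∈ G, τ.support = σ.support → ∃ t : K, f t = τ := by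
    intro τ hτ h
    have h1 : f (τ.subtypePerm (p := fun x => x ∈ σ.support)
        (fun x => by rw [← h, Perm.apply_mem_support])) = τ :=
      Perm.ofSubtype_subtypePerm _ (fun x hx => by rw [← h, Perm.mem_support]; exact hx)
    exact ⟨⟨_, show f _ ∈ G from h1.symm ▸ hτ⟩, h1⟩
  obtain ⟨s, hs⟩ := lift σ hσ rfl
  obtain ⟨s', hs'⟩ := lift σ' hσ' hsupp
  have hord : ∀ t : K, orderOf t = orderOf (f t) := by
    intro t
    rw [orderOf_injective f hf, Subgroup.orderOf_coe]
  have hcard : Nat.card K ∣ (σ.support.card).factorial := by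
    have := Subgroup.card_subgroup_dvd_card K
    rwa [Nat.card_perm, Nat.card_eq_fintype_card (α := σ.support), Fintype.card_coe] at this
  obtain ⟨k, hk⟩ := sylow_conj_aux hp hcard s s' (by rw [hord, hs, ho]) (by rw [hord, hs', ho'])
  refine ⟨f k, k.2, fun x hx => Perm.ofSubtype_apply_of_not_mem _ hx, ?_⟩
  obtain ⟨i, hi⟩ := Subgroup.mem_zpowers_iff.1 hk
  refine Subgroup.mem_zpowers_iff.2 ⟨i, ?_⟩
  have := congrArg (fun t : K => f t) hi
  simpa [hs, hs'] using this

open Equiv MulAction in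
/-- A cycle of prime length in a primitive group makes it multiply transitive:
every permutation can be realized on the fixed points of the cycle. -/
theorem realize_aux {Ω : Type*} [Fintype Ω] [DecidableEq Ω] (G : Subgroup (Perm Ω))
    (hG : IsPreprimitive G Ω) (σ : Perm Ω) (hσ : σ ∈ G) (hc : σ.IsCycle)
    (hp : (σ.support.card).Prime) (hle : σ.support.card + 3 ≤ Fintype.card Ω) (τ : Perm Ω) :
    ∃ g ∈ G, ∀ x ∉ σ.support, g x = τ x := by
  classical
  obtain ⟨m, hm⟩ : ∃ m, Fintype.card Ω = σ.support.card + (m + 1) :=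
    ⟨Fintype.card Ω - σ.support.card - 1, by omega⟩
  have hsc : Set.ncard ((σ.support : Set Ω)ᶜ) = m + 1 := by
    apply Nat.add_left_cancel
    rw [Set.ncard_add_ncard_compl, Set.ncard_coe_finset, Nat.card_eq_fintype_card, hm]
  have htwo := hp.two_le
  have hmp : IsMultiplyPreprimitive G Ω (m + 2) := by
    apply hG.isMultiplyPreprimitive hsc
    · rw [Nat.card_eq_fintype_card]; omega
    have := Perm.isPretransitive_of_isCycle_mem hc hσ
    apply IsPreprimitive.of_prime_card
    convert! hp
    rw [Nat.card_eq_fintype_card, Fintype.card_subtype]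
    apply congr_arg
    ext x
    simp [SubMulAction.mem_ofFixingSubgroup_iff]
  have hmt2 : IsMultiplyPretransitive G Ω (m + 2) := hmp.isMultiplyPretransitive
  have hmt : IsMultiplyPretransitive G Ω (m + 1) :=
    isMultiplyPretransitive_of_le (n := m + 2) (by omega) (by rw [Nat.card_eq_fintype_card]; omega)
  have hcc : Fintype.card {x // x ∉ σ.support} = m + 1 := by
    rw [← hsc, ← Nat.card_coe_set_eq, Nat.card_eq_fintype_card]
    exact Fintype.card_congr (Equiv.subtypeEquivRight (by simp))
  let e := Fintype.equivFinOfCardEq hcc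
  let x : Fin (m + 1) ↪ Ω := e.symm.toEmbedding.trans (Function.Embedding.subtype _)
  obtain ⟨g, hg⟩ := exists_smul_eq G x (x.trans τ.toEmbedding)
  refine ⟨g, g.2, fun y hy => ?_⟩
  have := DFunLike.congr_fun hg (e ⟨y, hy⟩)
  simpa [x] using! this

open Equiv in
/-- The element can be chosen to normalize the subgroup generated by the cycle. -/
theorem normalize_aux {Ω : Type*} [Fintype Ω] [DecidableEq Ω] (G : Subgroup (Perm Ω))
    (hG : MulAction.IsPreprimitive G Ω) (σ : Perm Ω) (hσ : σ ∈ G) (hc : σ.IsCycle)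
    (hp : (σ.support.card).Prime) (hle : σ.support.card + 3 ≤ Fintype.card Ω) (τ : Perm Ω)
    (hτ : ∀ x, τ x ∈ σ.support ↔ x ∈ σ.support) :
    ∃ g ∈ G, (∀ x ∉ σ.support, g x = τ x) ∧ g * σ * g⁻¹ ∈ Subgroup.zpowers σ := by
  obtain ⟨g, hg, hgτ⟩ := realize_aux G hG σ hσ hc hp hle τ
  have hsupp : (g * σ * g⁻¹).support = σ.support := by
    symm
    apply Finset.eq_of_subset_of_card_le
    · intro x hx
      rw [Perm.support_conj, Finset.mem_map_equiv]
      by_contra hcon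
      have h1 := hgτ _ hcon
      rw [Equiv.apply_symm_apply] at h1
      exact hcon ((hτ _).1 (h1 ▸ hx))
    · rw [Perm.support_conj, Finset.card_map]
  obtain ⟨k, hk, hkf, hkz⟩ := perm_conj_aux G σ (g * σ * g⁻¹) hσ
    (G.mul_mem (G.mul_mem hg hσ) (G.inv_mem hg)) hp hc.orderOf
    (by rw [← hc.orderOf]; exact orderOf_injective (MulAut.conj g).toMonoidHom
          (MulAut.conj g).injective σ) hsupp
  refine ⟨k * g, G.mul_mem hk hg, fun x hx => ?_, ?_⟩
  · rw [Perm.mul_apply, hgτ x hx, hkf _ (fun h => hx ((hτ x).1 h))]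
  · simpa [mul_assoc] using hkz

/-- If `a` and `b` normalize the cyclic group generated by `s`, then their
commutator centralizes `s`. -/
theorem commutator_aux {H : Type*} [Group H] (s a b : H)
    (ha : a * s * a⁻¹ ∈ Subgroup.zpowers s) (hb : b * s * b⁻¹ ∈ Subgroup.zpowers s) :
    Commute (a⁻¹ * b⁻¹ * a * b) s := by
  obtain ⟨i, hi⟩ := Subgroup.mem_zpowers_iff.1 ha
  obtain ⟨j, hj⟩ := Subgroup.mem_zpowers_iff.1 hb
  have h1 : (a * b) * s * (a * b)⁻¹ = (b * a) * s * (b * a)⁻¹ := by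
    calc (a * b) * s * (a * b)⁻¹ = a * (b * s * b⁻¹) * a⁻¹ := by group
      _ = (a * s * a⁻¹) ^ j := by rw [← hj, conj_zpow]
      _ = (b * s * b⁻¹) ^ i := by rw [← hi, ← hj, ← zpow_mul, ← zpow_mul, mul_comm]
      _ = b * (a * s * a⁻¹) * b⁻¹ := by rw [← hi, conj_zpow]
      _ = _ := by group
  have h2 : a⁻¹ * b⁻¹ * a * b * s = (b * a)⁻¹ * ((a * b) * s * (a * b)⁻¹) * (a * b) := by group
  rw [Commute, SemiconjBy, h2, h1]
  group

/-- **Jordan's theorem.** If `G` is a primitive permutation group of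
degree `n` containing a cycle of prime length `l ≤ n − 3`, then `G ⊇ Aₙ`. -/
theorem jordan_prime_cycle_implies_alternating_le
    {Ω : Type*} [Fintype Ω] [DecidableEq Ω] (G : Subgroup (Equiv.Perm Ω))
    (hprim : IsPrimitiveAction G Ω)
    (σ : Equiv.Perm Ω) (hσG : σ ∈ G) (hcycle : σ.IsCycle)
    (hprime : (σ.support.card).Prime)
    (hle : σ.support.card ≤ Fintype.card Ω - 3) :
    alternatingGroup Ω ≤ G := by
  have hG : MulAction.IsPreprimitive G Ω :=
    { toIsPretransitive := hprim.1
      isTrivialBlock_of_isBlock := fun {B} hB => hprim.2 B hB }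
  have htwo := hprime.two_le
  have hle' : σ.support.card + 3 ≤ Fintype.card Ω := by omega
  -- three distinct fixed points of the cycle
  obtain ⟨x, y, z, hx, hy, hz, hxy, hxz, hyz⟩ : ∃ x y z, x ∉ σ.support ∧ y ∉ σ.support ∧
      z ∉ σ.support ∧ x ≠ y ∧ x ≠ z ∧ y ≠ z := by
    have : 2 < (σ.supportᶜ).card := by rw [Finset.card_compl]; omega
    obtain ⟨x, y, z, hx, hy, hz, h⟩ := Finset.two_lt_card_iff.1 this
    exact ⟨x, y, z, Finset.mem_compl.1 hx, Finset.mem_compl.1 hy, Finset.mem_compl.1 hz, h⟩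
  have hswap : ∀ u v, u ∉ σ.support → v ∉ σ.support →
      ∀ w, Equiv.swap u v w ∈ σ.support ↔ w ∈ σ.support := by
    intro u v hu hv w
    rcases eq_or_ne w u with rfl | h1
    · simp only [Equiv.swap_apply_left, hu, hv]
    rcases eq_or_ne w v with rfl | h2
    · simp only [Equiv.swap_apply_right, hu, hv]
    rw [Equiv.swap_apply_of_ne_of_ne h1 h2]
  have hinv : ∀ (g : Equiv.Perm Ω) (u v : Ω), u ∉ σ.support → v ∉ σ.support →
      (∀ w ∉ σ.support, g w = Equiv.swap u v w) →
      ∀ w ∉ σ.support, g⁻¹ w = Equiv.swap u v w := by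
    intro g u v hu hv hg w hw
    rw [Equiv.Perm.inv_eq_iff_eq, hg _ (fun h => hw ((hswap u v hu hv w).1 h)),
      Equiv.swap_apply_self]
  obtain ⟨a, haG, haf, haz⟩ := normalize_aux G hG σ hσG hcycle hprime hle' (Equiv.swap x y)
    (hswap x y hx hy)
  obtain ⟨b, hbG, hbf, hbz⟩ := normalize_aux G hG σ hσG hcycle hprime hle' (Equiv.swap x z)
    (hswap x z hx hz)
  have hcomm := commutator_aux σ a b haz hbz
  have hcG : a⁻¹ * b⁻¹ * a * b ∈ G :=
    G.mul_mem (G.mul_mem (G.mul_mem (G.inv_mem haG) (G.inv_mem hbG)) haG) hbG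
  let q : Equiv.Perm Ω := Equiv.swap x y * Equiv.swap x z
  have hq : (q * q).IsThreeCycle :=
    (Equiv.Perm.isThreeCycle_swap_mul_swap_same hxy hxz hyz).isThreeCycle_sq
  -- the commutator acts as `q * q` on the fixed points of the cycle
  have hcf : ∀ w ∉ σ.support, (a⁻¹ * b⁻¹ * a * b) w = (q * q) w := by
    intro w hw
    have hw1 : Equiv.swap x z w ∉ σ.support := fun h => hw ((hswap x z hx hz _).1 h)
    have hw2 : Equiv.swap x y (Equiv.swap x z w) ∉ σ.support :=
      fun h => hw1 ((hswap x y hx hy _).1 h)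
    have hw3 : Equiv.swap x z (Equiv.swap x y (Equiv.swap x z w)) ∉ σ.support :=
      fun h => hw2 ((hswap x z hx hz _).1 h)
    simp only [Equiv.Perm.mul_apply, q]
    rw [hbf w hw, haf _ hw1, hinv b x z hx hz hbf _ hw2, hinv a x y hx hy haf _ hw3]
  have hqs : ∀ w, (q * q) w ∈ σ.support ↔ w ∈ σ.support := by
    intro w
    simp only [Equiv.Perm.mul_apply, q]
    rw [hswap x y hx hy, hswap x z hx hz, hswap x y hx hy, hswap x z hx hz]
  have hqf : ∀ w ∈ σ.support, (q * q) w = w := by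
    intro w hw
    have h1 : w ≠ x := fun h => hx (h ▸ hw)
    have h2 : w ≠ y := fun h => hy (h ▸ hw)
    have h3 : w ≠ z := fun h => hz (h ▸ hw)
    simp only [Equiv.Perm.mul_apply, q, Equiv.swap_apply_of_ne_of_ne h1 h3,
      Equiv.swap_apply_of_ne_of_ne h1 h2]
  generalize a⁻¹ * b⁻¹ * a * b = c at hcomm hcG hcf
  -- the commutator acts as a power of the cycle on its support
  obtain ⟨hc', hcz⟩ := hcycle.commute_iff.1 hcomm
  obtain ⟨i, hi⟩ := Subgroup.mem_zpowers_iff.1 hcz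
  have hcs : ∀ w ∈ σ.support, c w = (σ ^ i) w := by
    intro w hw
    rw [hi, Equiv.Perm.ofSubtype_apply_of_mem _ hw, Equiv.Perm.subtypePerm_apply]
  have key : (σ ^ i)⁻¹ * c = q * q := by
    ext w
    rw [Equiv.Perm.mul_apply, Equiv.Perm.inv_eq_iff_eq]
    by_cases hw : w ∈ σ.support
    · rw [hcs w hw, hqf w hw]
    · rw [hcf w hw]
      symm
      apply Equiv.Perm.zpow_apply_eq_self_of_apply_eq_self
      rw [← Equiv.Perm.notMem_support]
      exact fun h => hw ((hqs w).1 h)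
  refine Equiv.Perm.alternatingGroup_le_of_isPreprimitive_of_isThreeCycle_mem hG hq ?_
  rw [← key]
  exact G.mul_mem (G.inv_mem (G.zpow_mem hσG i)) hcG
end

section
/- A transitive permutation group G of degree 36 that is generated by elements of odd order and contains an element whose cycle type is (1,1,1,7,9,17) is primitive, and hence (by Jordan's theorem applied to a suitable power yielding a 7-cycle) contains A₃₆; if moreover G is generated by elements of odd order then G = A₃₆. -/
open Equiv Equiv.Perm MulAction

lemma app_inv {α : Type*} (c : Perm α) (x : α) : c (c⁻¹ x) = x := by
  rw [← Perm.mul_apply, mul_inv_cancel, Perm.one_apply]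

lemma inv_app {α : Type*} (c : Perm α) (x : α) : c⁻¹ (c x) = x := by
  rw [← Perm.mul_apply, inv_mul_cancel, Perm.one_apply]

/-- If the supports of two permutations meet in exactly one point,
their commutator is a three-cycle. -/
lemma comm_isThreeCycle {α : Type*} [Fintype α] [DecidableEq α] (c d : Perm α) (x : α)
    (hc : c x ≠ x) (hd : d x ≠ x) (h : ∀ y, c y ≠ y → d y ≠ y → y = x) :
    (c * d * c⁻¹ * d⁻¹).IsThreeCycle := by
  have hcx : d (c x) = c x := by
    by_contra h1
    exact hc (h (c x) (fun h2 => hc (c.injective h2)) h1)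
  have hdx : c (d x) = d x := by
    by_contra h1
    exact hd (h (d x) h1 (fun h2 => hd (d.injective h2)))
  have hcd : c x ≠ d x := by
    intro h1
    rw [h1] at hcx
    exact hd (d.injective hcx)
  have hci : d (c⁻¹ x) = c⁻¹ x := by
    by_contra h1
    have h2 := h (c⁻¹ x) (by
      intro h3
      rw [app_inv] at h3
      apply hc
      nth_rewrite 1 [h3]
      simp) h1
    apply hc
    nth_rewrite 1 [← h2]
    simp
  have hdi : c (d⁻¹ x) = d⁻¹ x := by
    by_contra h1
    have h2 := h (d⁻¹ x) h1 (by
      intro h3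
      rw [app_inv] at h3
      apply hd
      nth_rewrite 1 [h3]
      simp)
    apply hd
    nth_rewrite 1 [← h2]
    simp
  rw [← card_support_eq_three_iff]
  have key : (c * d * c⁻¹ * d⁻¹).support = {x, c x, d x} := by
    ext y
    simp only [Perm.mem_support, Perm.mul_apply, Finset.mem_insert, Finset.mem_singleton]
    constructor
    · intro hy
      by_contra hne
      push Not at hne
      obtain ⟨h1, h2, h3⟩ := hne
      apply hy
      by_cases hyd : d y = y
      · have e1 : d⁻¹ y = y := by rw [Perm.inv_eq_iff_eq, hyd]
        rw [e1]
        by_cases e2 : d (c⁻¹ y) = c⁻¹ y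
        · rw [e2]; simp
        · by_cases e3 : c (c⁻¹ y) = c⁻¹ y
          · rw [← e3] at e2
            simp only [app_inv] at e2
            exact absurd hyd e2
          · exact absurd (by rw [← h _ e3 e2]; simp) h2
      · have e2 : d (d⁻¹ y) ≠ d⁻¹ y := by
          intro e
          apply hyd
          have := congrArg d e
          simpa using this
        by_cases e3 : c (d⁻¹ y) = d⁻¹ y
        · have e4 : c⁻¹ (d⁻¹ y) = d⁻¹ y := by rw [Perm.inv_eq_iff_eq, e3]
          rw [e4, app_inv]
          by_contra e5
          exact h1 (h y e5 hyd)
        · exact absurd (by rw [← h _ e3 e2]; simp) h3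
    · rintro (rfl | rfl | rfl)
      · rw [Perm.inv_eq_iff_eq.mpr hdi.symm, app_inv]
        exact hc
      · rw [Perm.inv_eq_iff_eq.mpr hcx.symm, inv_app, hdx]
        exact hcd.symm
      · rw [inv_app, hci, app_inv]
        exact hd.symm
  rw [key, Finset.card_eq_three]
  exact ⟨x, c x, d x, hc.symm, hd.symm, hcd, rfl⟩

/-- Extract a cycle of `z` as a power of `z`. -/
lemma exists_cycle_mem {α : Type*} [Fintype α] [DecidableEq α] (G : Subgroup (Perm α))
    (z : Perm α) (hz : z ∈ G) (n e k : ℕ) (m : Multiset ℕ) (hzc : z.cycleType = n ::ₘ m)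
    (hm : m.lcm ∣ e) (hn : e = n * k + 1) :
    ∃ c ∈ G, c.IsCycle ∧ c.support.card = n := by
  have : n ∈ z.cycleType := by rw [hzc]; simp
  obtain ⟨c, t, rfl, hdis, hc, hcn⟩ := mem_cycleType_iff.mp this
  refine ⟨c, ?_, hc, hcn⟩
  have ht : t.cycleType = m := by
    rw [hdis.cycleType_mul, hc.cycleType, hcn] at hzc
    simpa using hzc
  have h1 : t ^ e = 1 := by
    rw [← orderOf_dvd_iff_pow_eq_one, ← lcm_cycleType, ht]
    exact hm
  have h2 : c ^ e = c := by
    rw [hn, pow_succ, pow_mul, ← hcn, ← hc.orderOf, pow_orderOf_eq_one, one_pow, one_mul]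
  have h3 : (c * t) ^ e = c := by
    rw [hdis.commute.mul_pow, h1, h2, mul_one]
  rw [← h3]
  exact G.pow_mem hz e

open scoped Pointwise in
/-- The group is primitive. -/
lemma isPreprimitive_aux (G : Subgroup (Perm (Fin 36)))
    (htrans : IsPretransitive G (Fin 36))
    (S : Set (Perm (Fin 36))) (hSodd : ∀ s ∈ S, Odd (orderOf s))
    (hSgen : Subgroup.closure S = G)
    (w : Perm (Fin 36)) (hw : w ∈ G) (hwc : w.IsCycle) (hwn : w.support.card = 17)
    (B : Set (Fin 36)) (hB : IsBlock G B) : B.Subsingleton ∨ B = Set.univ := by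
  by_contra hcon
  push Not at hcon
  obtain ⟨hns, hnu⟩ := hcon
  obtain ⟨x, hx, hxc⟩ := id hwc
  obtain ⟨b, hb⟩ := hns.nonempty
  obtain ⟨g, hg⟩ := exists_smul_eq G b x
  set A : Set (Fin 36) := g • B with hA
  have hAB : IsBlock G A := hB.translate g
  have hxA : x ∈ A := hg ▸ Set.smul_mem_smul_set hb
  have hAnt : A.Nontrivial := by
    rw [← Set.one_lt_ncard_iff_nontrivial] at hns ⊢
    rwa [hA, Set.ncard_smul_set]
  have hAnu : A ≠ Set.univ := by
    intro h
    apply hnu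
    rw [hA, smul_eq_iff_eq_inv_smul] at h
    simpa using h
  have hfix : ∀ u ∈ G, ∀ y ∈ A, u y ∈ A → u • A = A := by
    intro u hu y hy huy
    have := (isBlock_iff_smul_eq_of_mem.mp hAB) (g := ⟨u, hu⟩) hy huy
    exact this
  have hwA : w • A = A := by
    obtain ⟨y, hy, hyx⟩ := hAnt.exists_ne x
    by_cases hwy : w y = y
    · exact hfix w hw y hy (by rwa [hwy])
    · obtain ⟨i, hi⟩ := hxc hwy
      have h1 := hfix (w ^ i) (G.zpow_mem hw i) x hxA (by rwa [hi])
      have hp : (Nat.card (Subgroup.zpowers w)).Prime := by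
        rw [Nat.card_zpowers, hwc.orderOf, hwn]; norm_num
      have : Fact (Nat.Prime (Nat.card (Subgroup.zpowers w))) := ⟨hp⟩
      have h2 : w ∈ Subgroup.zpowers (w ^ i) := by
        have h3 := mem_zpowers_of_prime_card (G := Subgroup.zpowers w) rfl
          (g := ⟨w ^ i, ⟨i, rfl⟩⟩) (g' := ⟨w, ⟨1, by simp⟩⟩) (by
            intro h4
            have h5 : w ^ i = 1 := congrArg Subtype.val h4
            rw [h5] at hi
            exact hyx hi.symm)
        obtain ⟨j, hj⟩ := h3
        exact ⟨j, congrArg Subtype.val hj⟩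
      have h3 : Subgroup.zpowers (w ^ i) ≤ stabilizer (Perm (Fin 36)) A := by
        rw [Subgroup.zpowers_le]
        exact h1
      exact h3 h2
  have hsub : (w.support : Set (Fin 36)) ⊆ A := by
    intro y hy
    obtain ⟨i, hi⟩ := hxc (Perm.mem_support.mp (by simpa using hy))
    have : w ^ i ∈ stabilizer (Perm (Fin 36)) A := Subgroup.zpow_mem _ hwA i
    have h1 : w ^ i • A = A := this
    rw [← hi, ← h1]
    exact Set.smul_mem_smul_set hxA
  have h17 : 17 ≤ A.ncard := by
    rw [← hwn, ← Set.ncard_coe_finset]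
    exact Set.ncard_le_ncard hsub
  have hdvd := hAB.ncard_dvd_card ⟨x, hxA⟩
  rw [Nat.card_fin] at hdvd
  have h36 : A.ncard ≠ 36 := by
    intro h
    apply hAnu
    apply Set.eq_of_subset_of_ncard_le (Set.subset_univ _)
    rw [h, Set.ncard_univ, Nat.card_fin]
  have h18 : A.ncard = 18 := by
    have := Nat.le_of_dvd (by norm_num) hdvd
    generalize A.ncard = q at *
    interval_cases q <;> revert hdvd h36 <;> decide
  have hall : G ≤ stabilizer (Perm (Fin 36)) A := by
    conv_lhs => rw [← hSgen]
    rw [Subgroup.closure_le]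
    intro s hs
    have hsG : s ∈ G := hSgen ▸ Subgroup.subset_closure hs
    have hcase : s • A = A ∨ Disjoint (s • A) A :=
      (isBlock_iff_smul_eq_or_disjoint.mp hAB) ⟨s, hsG⟩
    have h2 : s ^ 2 ∈ stabilizer (Perm (Fin 36)) A := by
      rw [mem_stabilizer_iff]
      rcases hcase with h | h
      · rw [pow_two, mul_smul, h, h]
      · have hcompl : s • A = Aᶜ := by
          apply Set.eq_of_subset_of_ncard_le h.subset_compl_right
          have := Set.ncard_add_ncard_compl A
          rw [Nat.card_fin] at this
          rw [Set.ncard_smul_set]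
          omega
        rw [pow_two, mul_smul, hcompl, Set.smul_set_compl, hcompl, compl_compl]
    obtain ⟨k, hk⟩ := hSodd s hs
    have h3 : s = (s ^ 2) ^ (k + 1) := by
      rw [← pow_mul, show 2 * (k + 1) = (2 * k + 1) + 1 by ring, pow_succ, ← hk,
        pow_orderOf_eq_one, one_mul]
    rw [h3]
    exact Subgroup.pow_mem _ h2 _
  apply hAnu
  rw [Set.eq_univ_iff_forall]
  intro y
  obtain ⟨u, hu⟩ := exists_smul_eq G x y
  have h1 : (u : Perm (Fin 36)) • A = A := hall u.2
  rw [← hu, ← h1]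
  exact Set.smul_mem_smul_set (a := (u : Perm (Fin 36))) hxA

/-- Jordan's theorem for a 7-cycle in degree 36. -/
lemma jordan_aux (G : Subgroup (Perm (Fin 36))) (hG : IsPreprimitive G (Fin 36))
    (c : Perm (Fin 36)) (hc : c ∈ G) (hcc : c.IsCycle) (hcn : c.support.card = 7) :
    alternatingGroup (Fin 36) ≤ G := by
  classical
  have h30 : IsMultiplyPreprimitive G (Fin 36) (28 + 2) := by
    apply hG.isMultiplyPreprimitive (s := (c.supportᶜ : Set (Fin 36)))
    · have := Set.ncard_add_ncard_compl (c.support : Set (Fin 36))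
      rw [Set.ncard_coe_finset, Nat.card_fin] at this
      omega
    · rw [Nat.card_fin]; norm_num
    have := isPretransitive_of_isCycle_mem hcc hc
    apply IsPreprimitive.of_prime_card
    convert! (by norm_num : Nat.Prime 7)
    rw [Nat.card_eq_fintype_card, Fintype.card_subtype, ← hcn]
    apply congr_arg
    ext x
    simp [SubMulAction.mem_ofFixingSubgroup_iff]
  have h30' : IsMultiplyPretransitive G (Fin 36) 30 :=
    IsMultiplyPreprimitive.isMultiplyPretransitive ..
  have h7 : IsMultiplyPretransitive G (Fin 36) 7 :=
    isMultiplyPretransitive_of_le' (n := 30) (by norm_num) (by simp; norm_num)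
  obtain ⟨x, hx⟩ : c.support.Nonempty := by
    rw [← Finset.card_pos, hcn]; norm_num
  obtain ⟨T, hT, hTn⟩ := Finset.exists_subset_card_eq (s := c.supportᶜ) (n := 6) (by
    rw [Finset.card_compl, hcn]; simp)
  have hxT : x ∉ T := fun h => Finset.mem_compl.mp (hT h) hx
  have hT7 : (insert x T).card = 7 := by rw [Finset.card_insert_of_notMem hxT, hTn]
  obtain ⟨g, hg⟩ := exists_smul_eq G (c.support.orderEmbOfFin hcn).toEmbedding
    ((insert x T).orderEmbOfFin hT7).toEmbedding
  have hg' : ∀ i, (g : Perm (Fin 36)) (c.support.orderEmbOfFin hcn i) =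
      (insert x T).orderEmbOfFin hT7 i := fun i => DFunLike.congr_fun hg i
  have hmem : ∀ y, y ∈ c.support ↔ (g : Perm (Fin 36)) y ∈ insert x T := by
    intro y
    constructor
    · intro hy
      have : y ∈ Set.range (c.support.orderEmbOfFin hcn) := by
        rw [Finset.range_orderEmbOfFin]; exact hy
      obtain ⟨i, rfl⟩ := this
      rw [hg']
      exact Finset.orderEmbOfFin_mem _ _ _
    · intro hy
      have : (g : Perm (Fin 36)) y ∈ Set.range ((insert x T).orderEmbOfFin hT7) := by
        rw [Finset.range_orderEmbOfFin]; exact hy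
      obtain ⟨i, hi⟩ := this
      rw [← hg'] at hi
      rw [← (g : Perm (Fin 36)).injective hi]
      exact Finset.orderEmbOfFin_mem _ _ _
  set d : Perm (Fin 36) := g * c * (g : Perm (Fin 36))⁻¹ with hd
  have hdG : d ∈ G := G.mul_mem (G.mul_mem g.2 hc) (G.inv_mem g.2)
  have hdm : ∀ y, d y ≠ y ↔ y ∈ insert x T := by
    intro y
    have := hmem ((g : Perm (Fin 36))⁻¹ y)
    rw [app_inv, Perm.mem_support] at this
    rw [← this, hd, Perm.mul_apply, Perm.mul_apply, not_iff_not, ← Perm.eq_inv_iff_eq]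
  have h3 := comm_isThreeCycle c d x (Perm.mem_support.mp hx) ((hdm x).mpr (by simp)) (by
    intro y hy hy'
    rw [hdm, Finset.mem_insert] at hy'
    rcases hy' with h | h
    · exact h
    · exact absurd (Perm.mem_support.mpr hy) (Finset.mem_compl.mp (hT h)))
  exact alternatingGroup_le_of_isPreprimitive_of_isThreeCycle_mem hG h3
    (G.mul_mem (G.mul_mem (G.mul_mem hc hdG) (G.inv_mem hc)) (G.inv_mem hdG))

/-- A transitive permutation group `G` of degree 36 that is
generated by elements of odd order and contains an element whose cycle type is
`(1,1,1,7,9,17)` (i.e. whose nontrivial cycle type is `{7,9,17}`) is primitive,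
contains `A₃₆`, and (being generated by elements of odd order) equals `A₃₆`. -/
theorem transitive_degree_thirtysix_eq_alternating
    (G : Subgroup (Equiv.Perm (Fin 36)))
    (htrans : MulAction.IsPretransitive G (Fin 36))
    (S : Set (Equiv.Perm (Fin 36))) (hSodd : ∀ s ∈ S, Odd (orderOf s))
    (hSgen : Subgroup.closure S = G)
    (z : Equiv.Perm (Fin 36)) (hz : z ∈ G)
    (hzcyc : z.cycleType = {7, 9, 17}) :
    IsPrimitiveAction G (Fin 36) ∧ alternatingGroup (Fin 36) ≤ G ∧
      G = alternatingGroup (Fin 36) := by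
  obtain ⟨w, hw, hwc, hwn⟩ := exists_cycle_mem G z hz 17 630 37 {7, 9}
    (by rw [hzcyc]; decide) (by decide) (by norm_num)
  obtain ⟨c, hc, hcc, hcn⟩ := exists_cycle_mem G z hz 7 918 131 {9, 17}
    (by rw [hzcyc]; decide) (by decide) (by norm_num)
  have hprim := isPreprimitive_aux G htrans S hSodd hSgen w hw hwc hwn
  have hG : IsPreprimitive G (Fin 36) :=
    { toIsPretransitive := htrans
      isTrivialBlock_of_isBlock := fun {B} hB => hprim B hB }
  have hle := jordan_aux G hG c hc hcc hcn
  refine ⟨⟨htrans, hprim⟩, hle, le_antisymm ?_ hle⟩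
  rw [← hSgen, Subgroup.closure_le]
  intro s hs
  obtain ⟨k, hk⟩ := hSodd s hs
  show s ∈ alternatingGroup (Fin 36)
  rw [Equiv.Perm.mem_alternatingGroup]
  have h1 : Equiv.Perm.sign s ^ (2 * k + 1) = 1 := by
    rw [← hk, ← map_pow, pow_orderOf_eq_one, map_one]
  rwa [pow_succ, pow_mul, Int.units_sq, one_pow, one_mul] at h1
end
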